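/- Let m, n be nonnegative integers and ω a real number. The function x ↦ (−1)^{m+n+1}·(Φ^{(m+n+1)}(x) + ω·Φ^{(m)}(x)·Φ^{(n)}(x)) is completely monotonic on (0,∞) if and only if ω ≤ (m+n+1)!/(m!·n!). -/

import Mathlib

/-- A function `f` is completely monotonic on a set `s` if it has derivatives of all
orders on `s` and `(-1)^n f^(n) ≥ 0` on `s` for every `n ≥ 0`. -/
def CompletelyMonotonicOn (f : ℝ → ℝ) (s : Set ℝ) : Prop :=
  (∀ n : ℕ, ∀ x ∈ s, DifferentiableAt ℝ (iteratedDeriv n f) x) ∧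
  ∀ n : ℕ, ∀ x ∈ s, 0 ≤ (-1:ℝ) ^ n * iteratedDeriv n f x

/-- `Φ x = x * ψ'(x) - 1`, where `ψ'` is the trigamma function, i.e. the second
derivative of the logarithm of the gamma function. -/
noncomputable def Phi (x : ℝ) : ℝ :=
  x * iteratedDeriv 2 (fun y => Real.log (Real.Gamma y)) x - 1

open Real Set Filter Topology MeasureTheory ProbabilityTheory

/-- The Laplace transform of a function on the positive half-line. -/
noncomputable def laplaceTransform (K : ℝ → ℝ) (x : ℝ) : ℝ :=
  ∫ t in Ioi 0, K t * exp (-(x * t))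

section laplaceTransform

theorem integral_pow_mul_exp_neg_mul_Ioi (n : ℕ) {x : ℝ} (hx : 0 < x) :
    ∫ t in Ioi 0, t ^ n * exp (-(x * t)) = n.factorial / x ^ (n + 1) := by
  have h := Real.integral_rpow_mul_exp_neg_mul_Ioi (a := n + 1) (by positivity) hx
  rw [Real.Gamma_nat_eq_factorial] at h
  simp only [add_sub_cancel_right, rpow_natCast] at h
  rw [h, ← Nat.cast_succ, rpow_natCast, one_div, inv_pow, Nat.succ_eq_add_one]
  field_simp

theorem integrableOn_pow_mul_exp_neg_mul_Ioi (n : ℕ) {x : ℝ} (hx : 0 < x) :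
    IntegrableOn (fun t ↦ t ^ n * exp (-(x * t))) (Ioi 0) :=
  .of_integral_ne_zero (by rw [integral_pow_mul_exp_neg_mul_Ioi n hx]; positivity)

variable {K : ℝ → ℝ}

theorem aestronglyMeasurable_of_integrableOn_mul_exp
    (hint : ∀ x > 0, IntegrableOn (fun t ↦ K t * exp (-(x * t))) (Ioi 0)) :
    AEStronglyMeasurable K (volume.restrict (Ioi 0)) := by
  have h := (hint 1 one_pos).aestronglyMeasurable.mul
    (Real.continuous_exp.aestronglyMeasurable (μ := volume.restrict (Ioi 0)))
  refine h.congr (ae_of_all _ fun t ↦ ?_)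
  simp [mul_assoc, ← Real.exp_add]

/-- The measure on the half-line with density `K`. -/
noncomputable def densityMeasure (K : ℝ → ℝ) : Measure ℝ :=
  (volume.restrict (Ioi 0)).withDensity fun t ↦ ENNReal.ofReal (K t)

theorem integral_densityMeasure (hK : ∀ t > 0, 0 ≤ K t)
    (hint : ∀ x > 0, IntegrableOn (fun t ↦ K t * exp (-(x * t))) (Ioi 0)) (f : ℝ → ℝ) :
    ∫ t, f t ∂densityMeasure K = ∫ t in Ioi 0, K t * f t := by
  rw [densityMeasure, integral_withDensity_eq_integral_toReal_smul₀
    (aestronglyMeasurable_of_integrableOn_mul_exp hint).aemeasurable.ennreal_ofReal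
    (ae_of_all _ fun _ ↦ ENNReal.ofReal_lt_top)]
  refine setIntegral_congr_fun measurableSet_Ioi fun t ht ↦ ?_
  simp [ENNReal.toReal_ofReal (hK t ht)]

theorem integrable_densityMeasure_iff (hK : ∀ t > 0, 0 ≤ K t)
    (hint : ∀ x > 0, IntegrableOn (fun t ↦ K t * exp (-(x * t))) (Ioi 0)) (f : ℝ → ℝ) :
    Integrable f (densityMeasure K) ↔ IntegrableOn (fun t ↦ K t * f t) (Ioi 0) := by
  rw [densityMeasure, integrable_withDensity_iff_integrable_smul₀'
    (aestronglyMeasurable_of_integrableOn_mul_exp hint).aemeasurable.ennreal_ofReal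
    (ae_of_all _ fun _ ↦ ENNReal.ofReal_lt_top)]
  refine integrableOn_congr_fun (fun t ht ↦ ?_) measurableSet_Ioi
  simp [ENNReal.toReal_ofReal (hK t ht)]

theorem mgf_neg_densityMeasure (hK : ∀ t > 0, 0 ≤ K t)
    (hint : ∀ x > 0, IntegrableOn (fun t ↦ K t * exp (-(x * t))) (Ioi 0)) :
    mgf (fun t ↦ -t) (densityMeasure K) = laplaceTransform K := by
  ext x
  rw [mgf, integral_densityMeasure hK hint, laplaceTransform]
  simp

theorem mem_interior_integrableExpSet_densityMeasure (hK : ∀ t > 0, 0 ≤ K t)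
    (hint : ∀ x > 0, IntegrableOn (fun t ↦ K t * exp (-(x * t))) (Ioi 0)) {x : ℝ} (hx : 0 < x) :
    x ∈ interior (integrableExpSet (fun t ↦ -t) (densityMeasure K)) := by
  refine mem_interior.2 ⟨Ioi 0, fun y hy ↦ ?_, isOpen_Ioi, hx⟩
  refine (integrable_densityMeasure_iff hK hint _).2 ?_
  simpa using hint y hy

theorem iteratedDeriv_laplaceTransform (hK : ∀ t > 0, 0 ≤ K t)
    (hint : ∀ x > 0, IntegrableOn (fun t ↦ K t * exp (-(x * t))) (Ioi 0)) (n : ℕ)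
    {x : ℝ} (hx : 0 < x) :
    iteratedDeriv n (laplaceTransform K) x =
      (-1) ^ n * laplaceTransform (fun t ↦ t ^ n * K t) x := by
  rw [← mgf_neg_densityMeasure hK hint,
    iteratedDeriv_mgf (mem_interior_integrableExpSet_densityMeasure hK hint hx),
    integral_densityMeasure hK hint, laplaceTransform, ← integral_const_mul]
  congr with t
  rw [neg_pow]
  ring_nf

theorem differentiableAt_iteratedDeriv_laplaceTransform (hK : ∀ t > 0, 0 ≤ K t)
    (hint : ∀ x > 0, IntegrableOn (fun t ↦ K t * exp (-(x * t))) (Ioi 0)) (n : ℕ)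
    {x : ℝ} (hx : 0 < x) :
    DifferentiableAt ℝ (iteratedDeriv n (laplaceTransform K)) x := by
  rw [← mgf_neg_densityMeasure hK hint]
  exact differentiableAt_iteratedDeriv_mgf
    (mem_interior_integrableExpSet_densityMeasure hK hint hx) n

theorem completelyMonotonicOn_of_eqOn_laplaceTransform (hK : ∀ t > 0, 0 ≤ K t)
    (hint : ∀ x > 0, IntegrableOn (fun t ↦ K t * exp (-(x * t))) (Ioi 0)) {f : ℝ → ℝ}
    (hf : EqOn f (laplaceTransform K) (Ioi 0)) : CompletelyMonotonicOn f (Ioi 0) := by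
  refine ⟨fun n x hx ↦ ?_, fun n x hx ↦ ?_⟩
  · exact (differentiableAt_iteratedDeriv_laplaceTransform hK hint n hx).congr_of_eventuallyEq
      ((hf.iteratedDeriv_of_isOpen isOpen_Ioi n).eventuallyEq_of_mem (Ioi_mem_nhds hx))
  · rw [hf.iteratedDeriv_of_isOpen isOpen_Ioi n hx, iteratedDeriv_laplaceTransform hK hint n hx,
      ← mul_assoc, ← mul_pow]
    simp only [mul_neg, mul_one, neg_neg, one_pow, one_mul]
    refine setIntegral_nonneg measurableSet_Ioi fun t (ht : 0 < t) ↦ ?_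
    have := hK t ht
    positivity

/-- Abelian theorem: the Laplace transform of `t ^ n * g t` behaves like `n! c / x ^ (n + 1)` at
the origin when `g` is bounded and tends to `c` at infinity. -/
theorem tendsto_pow_mul_laplaceTransform {g : ℝ → ℝ} {c C : ℝ} (n : ℕ)
    (hg : ContinuousOn g (Ioi 0)) (hb : ∀ t > 0, |g t| ≤ C) (hlim : Tendsto g atTop (𝓝 c)) :
    Tendsto (fun x ↦ x ^ (n + 1) * laplaceTransform (fun t ↦ t ^ n * g t) x) (𝓝[>] 0)
      (𝓝 (n.factorial * c)) := by
  have key : Tendsto (fun x : ℝ ↦ ∫ u in Ioi 0, u ^ n * g (x⁻¹ * u) * exp (-u)) (𝓝[>] 0)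
      (𝓝 (∫ u in Ioi (0 : ℝ), u ^ n * c * exp (-u))) := by
    refine tendsto_integral_filter_of_dominated_convergence (fun u ↦ C * (u ^ n * exp (-(1 * u))))
      ?_ ?_ ((integrableOn_pow_mul_exp_neg_mul_Ioi n one_pos).const_mul C) ?_
    · filter_upwards [self_mem_nhdsWithin] with x (hx : 0 < x)
      refine ContinuousOn.aestronglyMeasurable ?_ measurableSet_Ioi
      refine ((continuousOn_id.pow n).mul (hg.comp (by fun_prop) fun u (hu : 0 < u) ↦ ?_)).mul
        (by fun_prop)
      exact mul_pos (inv_pos.2 hx) hu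
    · filter_upwards [self_mem_nhdsWithin] with x (hx : 0 < x)
      refine (ae_restrict_iff' measurableSet_Ioi).2 (ae_of_all _ fun u (hu : 0 < u) ↦ ?_)
      rw [norm_mul, norm_mul, norm_of_nonneg (by positivity : 0 ≤ u ^ n),
        norm_of_nonneg (exp_pos _).le, one_mul, norm_eq_abs, mul_comm (u ^ n), mul_assoc]
      gcongr
      exact hb _ (by positivity)
    · refine (ae_restrict_iff' measurableSet_Ioi).2 (ae_of_all _ fun u (hu : 0 < u) ↦ ?_)
      refine ((hlim.comp ?_).const_mul (u ^ n)).mul_const _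
      exact tendsto_inv_nhdsGT_zero.atTop_mul_const hu
  have hval : ∫ u in Ioi (0 : ℝ), u ^ n * c * exp (-u) = n.factorial * c := by
    have := integral_pow_mul_exp_neg_mul_Ioi n one_pos
    simp only [one_mul, one_pow, div_one] at this
    rw [← this, ← integral_mul_const]
    congr with u
    ring
  rw [hval] at key
  refine key.congr' ?_
  filter_upwards [self_mem_nhdsWithin] with x (hx : 0 < x)
  have h := integral_comp_mul_left_Ioi (fun u ↦ u ^ n * g (x⁻¹ * u) * exp (-u)) 0 hx
  rw [mul_zero, smul_eq_mul, eq_inv_mul_iff_mul_eq₀ hx.ne'] at h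
  rw [← h, laplaceTransform, pow_succ', mul_assoc, ← integral_const_mul (x ^ n)]
  congr with t
  rw [inv_mul_cancel_left₀ hx.ne', mul_pow]
  ring

end laplaceTransform

section kernels

/-- The density whose Laplace transform is the trigamma function. -/
noncomputable def trigammaKernel (t : ℝ) : ℝ := t / (1 - exp (-t))

/-- The derivative of `trigammaKernel`, whose Laplace transform is `Phi`. -/
noncomputable def phiKernel (t : ℝ) : ℝ :=
  (1 - exp (-t) - t * exp (-t)) / (1 - exp (-t)) ^ 2

theorem one_sub_exp_neg_pos {t : ℝ} (ht : 0 < t) : 0 < 1 - exp (-t) := by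
  simpa using ht

theorem one_add_mul_exp_neg_le_one (t : ℝ) : (1 + t) * exp (-t) ≤ 1 := by
  rw [exp_neg, ← div_eq_mul_inv, div_le_one (exp_pos t), add_comm]
  exact add_one_le_exp t

theorem trigammaKernel_pos {t : ℝ} (ht : 0 < t) : 0 < trigammaKernel t :=
  div_pos ht (one_sub_exp_neg_pos ht)

theorem trigammaKernel_le {t : ℝ} (ht : 0 < t) : trigammaKernel t ≤ 1 + t := by
  rw [trigammaKernel, div_le_iff₀ (one_sub_exp_neg_pos ht)]
  linarith [one_add_mul_exp_neg_le_one t]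

theorem hasDerivAt_exp_neg (t : ℝ) : HasDerivAt (fun t ↦ exp (-t)) (-exp (-t)) t := by
  simpa using (hasDerivAt_neg t).exp

theorem hasDerivAt_trigammaKernel {t : ℝ} (ht : 0 < t) :
    HasDerivAt trigammaKernel (phiKernel t) t := by
  have h := (hasDerivAt_id t).div ((hasDerivAt_exp_neg t).const_sub 1) (one_sub_exp_neg_pos ht).ne'
  convert! h using 1
  simp only [phiKernel, id]
  ring

theorem continuousOn_trigammaKernel : ContinuousOn trigammaKernel (Ioi 0) :=
  fun _ ht ↦ (hasDerivAt_trigammaKernel ht).continuousAt.continuousWithinAt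

theorem tendsto_trigammaKernel_nhdsGT_zero : Tendsto trigammaKernel (𝓝[>] 0) (𝓝 1) := by
  have h := (hasDerivAt_iff_tendsto_slope.1 (hasDerivAt_exp_neg 0)).mono_left
    (nhdsWithin_mono (0 : ℝ) (fun x (hx : 0 < x) ↦ hx.ne' : Ioi (0 : ℝ) ⊆ {0}ᶜ))
  have h' := h.neg.inv₀ (by simp)
  simp only [neg_zero, exp_zero, neg_neg, inv_one] at h'
  refine h'.congr fun t ↦ ?_
  rw [slope_def_field, trigammaKernel, neg_zero, exp_zero, sub_zero, ← neg_div, neg_sub, inv_div]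

theorem phiKernel_nonneg (t : ℝ) : 0 ≤ phiKernel t :=
  div_nonneg (by linarith [one_add_mul_exp_neg_le_one t]) (sq_nonneg _)

theorem phiKernel_le_one {t : ℝ} (ht : 0 < t) : phiKernel t ≤ 1 := by
  rw [phiKernel, div_le_one (pow_pos (one_sub_exp_neg_pos ht) 2)]
  nlinarith [add_one_le_exp (-t), exp_pos (-t)]

theorem abs_phiKernel_le_one {t : ℝ} (ht : 0 < t) : |phiKernel t| ≤ 1 := by
  rw [abs_of_nonneg (phiKernel_nonneg t)]
  exact phiKernel_le_one ht

theorem two_mul_one_sub_exp_neg_le {t : ℝ} (ht : 0 ≤ t) :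
    2 * (1 - exp (-t)) ≤ t * (1 + exp (-t)) := by
  have hd (s : ℝ) : HasDerivAt (fun s ↦ s * (1 + exp (-s)) - 2 * (1 - exp (-s)))
      (1 - exp (-s) - s * exp (-s)) s := by
    have h := ((hasDerivAt_id s).mul ((hasDerivAt_exp_neg s).const_add 1)).sub
      (((hasDerivAt_exp_neg s).const_sub 1).const_mul 2)
    convert! h using 1
    simp only [id]
    ring
  have hm := monotone_of_hasDerivAt_nonneg hd fun s ↦ by
    simp only [Pi.zero_apply]
    linarith [one_add_mul_exp_neg_le_one s]
  have := hm ht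
  simp only [neg_zero, exp_zero] at this
  linarith

theorem hasDerivAt_phiKernel {t : ℝ} (ht : 0 < t) :
    HasDerivAt phiKernel
      (exp (-t) * (t * (1 + exp (-t)) - 2 * (1 - exp (-t))) / (1 - exp (-t)) ^ 3) t := by
  have h0 := (one_sub_exp_neg_pos ht).ne'
  have he := hasDerivAt_exp_neg t
  have h := ((he.const_sub 1).sub ((hasDerivAt_id t).mul he)).div ((he.const_sub 1).pow 2)
    (pow_ne_zero 2 h0)
  convert! h using 1
  simp only [id, Pi.pow_apply, Pi.sub_apply, Pi.mul_apply]
  field_simp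
  ring

theorem continuousOn_phiKernel : ContinuousOn phiKernel (Ioi 0) :=
  fun _ ht ↦ (hasDerivAt_phiKernel ht).continuousAt.continuousWithinAt

theorem monotoneOn_phiKernel : MonotoneOn phiKernel (Ioi 0) := by
  refine monotoneOn_of_deriv_nonneg (convex_Ioi 0) continuousOn_phiKernel
    (fun t ht ↦ ?_) fun t ht ↦ ?_
  · rw [interior_Ioi] at ht
    exact (hasDerivAt_phiKernel ht).differentiableAt.differentiableWithinAt
  · rw [interior_Ioi] at ht
    rw [(hasDerivAt_phiKernel ht).deriv]
    have h1 := one_sub_exp_neg_pos ht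
    have h2 := two_mul_one_sub_exp_neg_le (le_of_lt ht)
    exact div_nonneg (mul_nonneg (exp_pos _).le (sub_nonneg.2 h2)) (by positivity)

theorem phiKernel_mul_le {s t : ℝ} (hs : 0 < s) (hst : s < t) :
    phiKernel s * phiKernel (t - s) ≤ phiKernel t :=
  calc phiKernel s * phiKernel (t - s) ≤ phiKernel s * 1 := by
        gcongr
        · exact phiKernel_nonneg s
        · exact phiKernel_le_one (sub_pos.2 hst)
    _ ≤ phiKernel t := by
        rw [mul_one]
        exact monotoneOn_phiKernel hs (hs.trans hst) hst.le

theorem tendsto_phiKernel_atTop : Tendsto phiKernel atTop (𝓝 1) := by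
  have h1 : Tendsto (fun t : ℝ ↦ exp (-t)) atTop (𝓝 0) := tendsto_exp_neg_atTop_nhds_zero
  have h2 : Tendsto (fun t : ℝ ↦ t * exp (-t)) atTop (𝓝 0) := by
    simpa using tendsto_pow_mul_exp_neg_atTop_nhds_zero 1
  have h := ((h1.const_sub 1).sub h2).div ((h1.const_sub 1).pow 2) (by norm_num)
  convert! h using 1
  norm_num

theorem integrableOn_mul_exp_of_abs_le {g : ℝ → ℝ} {C : ℝ} (n : ℕ) (hg : ContinuousOn g (Ioi 0))
    (hb : ∀ t > 0, |g t| ≤ C) {x : ℝ} (hx : 0 < x) :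
    IntegrableOn (fun t ↦ t ^ n * g t * exp (-(x * t))) (Ioi 0) := by
  refine ((integrableOn_pow_mul_exp_neg_mul_Ioi n hx).const_mul C).mono' ?_ ?_
  · refine ContinuousOn.aestronglyMeasurable ?_ measurableSet_Ioi
    exact ((continuousOn_id.pow n).mul hg).mul (by fun_prop)
  · refine (ae_restrict_iff' measurableSet_Ioi).2 (ae_of_all _ fun t (ht : 0 < t) ↦ ?_)
    rw [norm_mul, norm_mul, norm_of_nonneg (by positivity : 0 ≤ t ^ n),
      norm_of_nonneg (exp_pos _).le, norm_eq_abs, mul_comm (t ^ n), mul_assoc]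
    gcongr
    exact hb t ht

theorem integrableOn_pow_mul_phiKernel (n : ℕ) {x : ℝ} (hx : 0 < x) :
    IntegrableOn (fun t ↦ t ^ n * phiKernel t * exp (-(x * t))) (Ioi 0) :=
  integrableOn_mul_exp_of_abs_le n continuousOn_phiKernel (fun _ ht ↦ abs_phiKernel_le_one ht) hx

theorem integrableOn_phiKernel {x : ℝ} (hx : 0 < x) :
    IntegrableOn (fun t ↦ phiKernel t * exp (-(x * t))) (Ioi 0) := by
  simpa using integrableOn_pow_mul_phiKernel 0 hx

theorem integrableOn_one_add_mul_exp {x : ℝ} (hx : 0 < x) :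
    IntegrableOn (fun t ↦ (1 + t) * exp (-(x * t))) (Ioi 0) := by
  refine ((integrableOn_pow_mul_exp_neg_mul_Ioi 0 hx).add
    (integrableOn_pow_mul_exp_neg_mul_Ioi 1 hx)).congr (ae_of_all _ fun t ↦ ?_)
  simp only [Pi.add_apply]
  ring

theorem integrableOn_trigammaKernel {x : ℝ} (hx : 0 < x) :
    IntegrableOn (fun t ↦ trigammaKernel t * exp (-(x * t))) (Ioi 0) := by
  refine (integrableOn_one_add_mul_exp hx).mono' ?_ ?_
  · refine ContinuousOn.aestronglyMeasurable ?_ measurableSet_Ioi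
    exact continuousOn_trigammaKernel.mul (by fun_prop)
  · refine (ae_restrict_iff' measurableSet_Ioi).2 (ae_of_all _ fun t (ht : 0 < t) ↦ ?_)
    rw [norm_mul, norm_of_nonneg (trigammaKernel_pos ht).le, norm_of_nonneg (exp_pos _).le]
    gcongr
    exact trigammaKernel_le ht

end kernels

section trigamma

theorem laplaceTransform_trigammaKernel_nonneg (x : ℝ) : 0 ≤ laplaceTransform trigammaKernel x :=
  setIntegral_nonneg measurableSet_Ioi fun _ ht ↦
    mul_nonneg (trigammaKernel_pos ht).le (exp_pos _).le

theorem laplaceTransform_trigammaKernel_le {x : ℝ} (hx : 0 < x) :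
    laplaceTransform trigammaKernel x ≤ 1 / x + 1 / x ^ 2 := by
  have h0 := integral_pow_mul_exp_neg_mul_Ioi 0 hx
  have h1 := integral_pow_mul_exp_neg_mul_Ioi 1 hx
  calc laplaceTransform trigammaKernel x ≤ ∫ t in Ioi 0, (1 + t) * exp (-(x * t)) := by
        refine setIntegral_mono_on (integrableOn_trigammaKernel hx)
          (integrableOn_one_add_mul_exp hx) measurableSet_Ioi fun t ht ↦ ?_
        gcongr
        exact trigammaKernel_le ht
    _ = (∫ t in Ioi 0, t ^ 0 * exp (-(x * t))) + ∫ t in Ioi 0, t ^ 1 * exp (-(x * t)) := by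
        rw [← integral_add (integrableOn_pow_mul_exp_neg_mul_Ioi 0 hx)
          (integrableOn_pow_mul_exp_neg_mul_Ioi 1 hx)]
        congr with t
        ring
    _ = 1 / x + 1 / x ^ 2 := by
        rw [h0, h1]
        simp

theorem laplaceTransform_trigammaKernel_add_one {x : ℝ} (hx : 0 < x) :
    laplaceTransform trigammaKernel (x + 1) = laplaceTransform trigammaKernel x - 1 / x ^ 2 := by
  have h1 : 1 / x ^ 2 = ∫ t in Ioi 0, t ^ 1 * exp (-(x * t)) := by
    rw [integral_pow_mul_exp_neg_mul_Ioi 1 hx]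
    simp
  rw [h1, laplaceTransform, laplaceTransform, ← integral_sub (integrableOn_trigammaKernel hx)
    (integrableOn_pow_mul_exp_neg_mul_Ioi 1 hx)]
  refine setIntegral_congr_fun measurableSet_Ioi fun t ht ↦ ?_
  have h0 := (one_sub_exp_neg_pos ht).ne'
  simp only [trigammaKernel]
  rw [show -((x + 1) * t) = -(x * t) + -t by ring, exp_add]
  field_simp
  ring

theorem differentiableAt_laplaceTransform_trigammaKernel {x : ℝ} (hx : 0 < x) :
    DifferentiableAt ℝ (laplaceTransform trigammaKernel) x := by
  simpa using differentiableAt_iteratedDeriv_laplaceTransform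
    (fun _ ht ↦ (trigammaKernel_pos ht).le) (fun _ hx ↦ integrableOn_trigammaKernel hx) 0 hx

theorem hasDerivAt_integral_of_continuousOn_Ioi {f : ℝ → ℝ} (hf : ContinuousOn f (Ioi 0)) {x : ℝ}
    (hx : 0 < x) : HasDerivAt (fun x ↦ ∫ t in (1 : ℝ)..x, f t) (f x) x := by
  refine intervalIntegral.integral_hasDerivAt_right
    (hf.mono fun t ht ↦ (lt_min one_pos hx).trans_le ht.1).intervalIntegrable
    (hf.stronglyMeasurableAtFilter isOpen_Ioi x hx) (hf.continuousAt (Ioi_mem_nhds hx))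

theorem constant_of_hasDerivAt_eq_zero {f : ℝ → ℝ} (hf : ∀ x > 0, HasDerivAt f 0 x) {x : ℝ}
    (hx : 0 < x) : f x = f 1 :=
  (convex_Ioi (0 : ℝ)).is_const_of_fderivWithin_eq_zero (𝕜 := ℝ)
    (fun y hy ↦ (hf y hy).differentiableAt.differentiableWithinAt)
    (fun y hy ↦ by
      rw [fderivWithin_of_isOpen isOpen_Ioi hy]
      ext
      simp [(hf y hy).deriv])
    hx (mem_Ioi.2 one_pos)

/-- The trigamma function is the Laplace transform of `trigammaKernel`. -/
theorem iteratedDeriv_two_log_Gamma {x : ℝ} (hx : 0 < x) :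
    iteratedDeriv 2 (fun y ↦ log (Gamma y)) x = laplaceTransform trigammaKernel x := by
  set T := laplaceTransform trigammaKernel with hT
  set P₁ : ℝ → ℝ := fun x ↦ ∫ t in (1 : ℝ)..x, T t with hP₁
  have hP₁' {y : ℝ} (hy : 0 < y) : HasDerivAt P₁ (T y) y :=
    hasDerivAt_integral_of_continuousOn_Ioi (fun z hz ↦
      (differentiableAt_laplaceTransform_trigammaKernel hz).continuousAt.continuousWithinAt) hy
  set P₂ : ℝ → ℝ := fun x ↦ ∫ t in (1 : ℝ)..x, P₁ t with hP₂
  have hP₂' {y : ℝ} (hy : 0 < y) : HasDerivAt P₂ (P₁ y) y :=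
    hasDerivAt_integral_of_continuousOn_Ioi (fun z hz ↦
      (hP₁' hz).continuousAt.continuousWithinAt) hy
  have hP₁_const {y : ℝ} (hy : 0 < y) : P₁ (y + 1) - P₁ y - y⁻¹ = P₁ (1 + 1) - P₁ 1 - 1⁻¹ := by
    refine constant_of_hasDerivAt_eq_zero (f := fun y ↦ P₁ (y + 1) - P₁ y - y⁻¹)
      (fun z hz ↦ ?_) hy
    convert! (((hP₁' (add_pos hz one_pos)).comp_add_const z 1).sub (hP₁' hz)).sub
      (hasDerivAt_inv hz.ne') using 1
    rw [hT, laplaceTransform_trigammaKernel_add_one hz]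
    ring
  have hP₁_lim : Tendsto (fun y ↦ P₁ (y + 1) - P₁ y - y⁻¹) atTop (𝓝 (0 - 0)) := by
    refine Tendsto.sub ?_ tendsto_inv_atTop_zero
    have h0 : Tendsto (fun y : ℝ ↦ 1 / y + 1 / y ^ 2) atTop (𝓝 0) := by
      have h := tendsto_inv_atTop_zero (𝕜 := ℝ)
      simpa using h.add (h.pow 2)
    refine tendsto_of_tendsto_of_tendsto_of_le_of_le' tendsto_const_nhds h0 ?_ ?_ <;>
    filter_upwards [eventually_gt_atTop 0] with y hy <;>
    obtain ⟨ξ, hξ, hξ'⟩ := exists_hasDerivAt_eq_slope P₁ T (lt_add_one y)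
      (fun z hz ↦ (hP₁' (hy.trans_le hz.1)).continuousAt.continuousWithinAt)
      (fun z hz ↦ hP₁' (hy.trans hz.1)) <;>
    rw [add_sub_cancel_left, div_one] at hξ' <;>
    rw [← hξ']
    · exact laplaceTransform_trigammaKernel_nonneg ξ
    · have hy' := hξ.1.le
      refine (laplaceTransform_trigammaKernel_le (hy.trans hξ.1)).trans ?_
      gcongr
  have hP₁_add {y : ℝ} (hy : 0 < y) : P₁ (y + 1) - P₁ y - y⁻¹ = 0 := by
    rw [hP₁_const hy]
    refine tendsto_nhds_unique (tendsto_const_nhds.congr' ?_) (by simpa using hP₁_lim)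
    filter_upwards [eventually_gt_atTop 0] with z hz using (hP₁_const hz).symm
  set a := P₂ (1 + 1) - P₂ 1 - log 1 with ha
  have hP₂_add {y : ℝ} (hy : 0 < y) : P₂ (y + 1) - P₂ y - log y = a := by
    refine constant_of_hasDerivAt_eq_zero (f := fun y ↦ P₂ (y + 1) - P₂ y - log y)
      (fun z hz ↦ ?_) hy
    convert! (((hP₂' (add_pos hz one_pos)).comp_add_const z 1).sub (hP₂' hz)).sub
      (hasDerivAt_log hz.ne') using 1
    rw [hP₁_add hz]
  set F : ℝ → ℝ := fun y ↦ P₂ y - a * y + a with hF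
  have hF' {y : ℝ} (hy : 0 < y) : HasDerivAt F (P₁ y - a) y := by
    have h := ((hP₂' hy).sub ((hasDerivAt_id y).const_mul a)).add_const a
    rw [mul_one] at h
    exact h
  have hderiv {y : ℝ} (hy : 0 < y) : deriv F =ᶠ[𝓝 y] fun y ↦ P₁ y - a := by
    filter_upwards [Ioi_mem_nhds hy] with z hz using (hF' hz).deriv
  have hF'' {y : ℝ} (hy : 0 < y) : HasDerivAt (deriv F) (T y) y :=
    ((hP₁' hy).sub_const a).congr_of_eventuallyEq (hderiv hy)
  have hconv : ConvexOn ℝ (Ioi 0) (log ∘ fun y ↦ exp (F y)) := by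
    have : (log ∘ fun y ↦ exp (F y)) = F := by ext; simp
    rw [this]
    refine convexOn_of_deriv2_nonneg' (convex_Ioi 0)
      (fun y hy ↦ (hF' hy).differentiableAt.differentiableWithinAt)
      (fun y hy ↦ (hF'' hy).differentiableAt.differentiableWithinAt) fun y hy ↦ ?_
    simp only [Function.iterate_succ, Function.iterate_zero, Function.comp_apply, id]
    rw [(hF'' hy).deriv]
    exact laplaceTransform_trigammaKernel_nonneg y
  have hΓ := eq_Gamma_of_log_convex hconv
    (fun {y} hy ↦ by
      have := hP₂_add hy
      rw [show F (y + 1) = log y + F y by simp only [hF]; linarith, exp_add, exp_log hy])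
    (fun _ ↦ exp_pos _) (by simp [hF, hP₂])
  have hlog : (fun y ↦ log (Gamma y)) =ᶠ[𝓝 x] F := by
    filter_upwards [Ioi_mem_nhds hx] with y hy
    rw [← hΓ hy, log_exp]
  rw [hlog.iteratedDeriv_eq, iteratedDeriv_succ, iteratedDeriv_one, (hF'' hx).deriv]

theorem Phi_eq_laplaceTransform {x : ℝ} (hx : 0 < x) :
    Phi x = laplaceTransform phiKernel x := by
  have hu (t : ℝ) (_ : t ∈ Ioi (0 : ℝ)) :
      HasDerivAt (fun t ↦ exp (-(x * t))) (-(x * exp (-(x * t)))) t := by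
    simpa [mul_comm] using ((hasDerivAt_id t).const_mul x).neg.exp
  have hint₁ := integrableOn_phiKernel hx
  have hint₂ := (integrableOn_trigammaKernel hx).const_mul x
  have h0 : Tendsto (trigammaKernel * fun t ↦ exp (-(x * t))) (𝓝[>] 0) (𝓝 1) := by
    have : Tendsto (fun t ↦ exp (-(x * t))) (𝓝[>] 0) (𝓝 1) :=
      Tendsto.mono_left (Continuous.tendsto' (by fun_prop) _ _ (by simp)) nhdsWithin_le_nhds
    have h := tendsto_trigammaKernel_nhdsGT_zero.mul this
    rwa [one_mul] at h
  have hinf : Tendsto (trigammaKernel * fun t ↦ exp (-(x * t))) atTop (𝓝 0) := by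
    have h1 : Tendsto (fun t : ℝ ↦ exp (-(x * t))) atTop (𝓝 0) :=
      tendsto_exp_neg_atTop_nhds_zero.comp (tendsto_id.const_mul_atTop hx)
    have h2 : Tendsto (fun t : ℝ ↦ t * exp (-(x * t))) atTop (𝓝 0) := by
      have h := (tendsto_pow_mul_exp_neg_atTop_nhds_zero 1).comp (tendsto_id.const_mul_atTop hx)
      have h' := h.const_mul x⁻¹
      rw [mul_zero] at h'
      refine h'.congr fun t ↦ ?_
      simp only [Function.comp_apply, id, pow_one]
      field_simp
    have h3 : Tendsto (fun t : ℝ ↦ (1 + t) * exp (-(x * t))) atTop (𝓝 0) := by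
      simpa [add_mul] using h1.add h2
    refine squeeze_zero' ?_ ?_ h3
    · filter_upwards [eventually_gt_atTop 0] with t ht
      exact mul_nonneg (trigammaKernel_pos ht).le (exp_pos _).le
    · filter_upwards [eventually_gt_atTop 0] with t ht
      exact mul_le_mul_of_nonneg_right (trigammaKernel_le ht) (exp_pos _).le
  have hint : IntegrableOn (phiKernel * (fun t ↦ exp (-(x * t))) +
      trigammaKernel * fun t ↦ -(x * exp (-(x * t)))) (Ioi 0) := by
    refine (hint₁.sub hint₂).congr (ae_of_all _ fun t ↦ ?_)
    simp only [Pi.sub_apply, Pi.add_apply, Pi.mul_apply]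
    ring
  have h := integral_Ioi_deriv_mul_eq_sub (fun t ht ↦ hasDerivAt_trigammaKernel ht) hu hint h0 hinf
  have h' : ∫ t in Ioi 0, phiKernel t * exp (-(x * t)) + trigammaKernel t * -(x * exp (-(x * t))) =
      laplaceTransform phiKernel x - x * laplaceTransform trigammaKernel x := by
    rw [laplaceTransform, laplaceTransform, ← integral_const_mul, ← integral_sub hint₁ hint₂]
    congr with t
    ring
  rw [h'] at h
  rw [Phi, iteratedDeriv_two_log_Gamma hx]
  linarith

theorem iteratedDeriv_Phi (n : ℕ) {x : ℝ} (hx : 0 < x) :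
    iteratedDeriv n Phi x = (-1) ^ n * laplaceTransform (fun t ↦ t ^ n * phiKernel t) x := by
  have h : EqOn Phi (laplaceTransform phiKernel) (Ioi 0) := fun y hy ↦ Phi_eq_laplaceTransform hy
  rw [h.iteratedDeriv_of_isOpen isOpen_Ioi n hx,
    iteratedDeriv_laplaceTransform (fun t _ ↦ phiKernel_nonneg t)
      (fun y hy ↦ integrableOn_phiKernel hy) n hx]

end trigamma

section convolution

theorem integral_pow_mul_sub_pow (m n : ℕ) {t : ℝ} (ht : 0 < t) :
    ∫ s in 0..t, s ^ m * (t - s) ^ n =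
      t ^ (m + n + 1) * (m.factorial * n.factorial / (m + n + 1).factorial) := by
  have hre (k : ℕ) : 0 < ((k : ℂ) + 1).re := by
    simp only [Complex.add_re, Complex.natCast_re, Complex.one_re]
    positivity
  have h := Complex.betaIntegral_scaled (m + 1) (n + 1) ht
  have hb := Complex.Gamma_mul_Gamma_eq_betaIntegral (hre m) (hre n)
  have hsum : ((m : ℂ) + 1 + (n + 1)) = ((m + n + 1 : ℕ) : ℂ) + 1 := by
    push_cast
    ring
  rw [hsum, Complex.Gamma_nat_eq_factorial, Complex.Gamma_nat_eq_factorial,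
    Complex.Gamma_nat_eq_factorial] at hb
  rw [hsum] at h
  simp only [add_sub_cancel_right, Complex.cpow_natCast] at h
  have hf : ((m + n + 1).factorial : ℂ) ≠ 0 := Nat.cast_ne_zero.2 (Nat.factorial_ne_zero _)
  rw [mul_comm _ (Complex.betaIntegral _ _), ← div_eq_iff hf] at hb
  rw [← hb] at h
  apply Complex.ofReal_injective
  rw [← intervalIntegral.integral_ofReal]
  push_cast
  exact h

/-- The convolution of `t ^ m * phiKernel t` and `t ^ n * phiKernel t` on the half-line. -/
noncomputable def phiConvolution (m n : ℕ) (t : ℝ) : ℝ :=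
  ∫ s in 0..t, s ^ m * phiKernel s * ((t - s) ^ n * phiKernel (t - s))

theorem phiConvolution_nonneg (m n : ℕ) {t : ℝ} (ht : 0 < t) : 0 ≤ phiConvolution m n t := by
  refine intervalIntegral.integral_nonneg ht.le fun s hs ↦ ?_
  have h1 := phiKernel_nonneg s
  have h2 := phiKernel_nonneg (t - s)
  have h3 := sub_nonneg.2 hs.2
  have h4 := hs.1
  positivity

theorem phiConvolution_le (m n : ℕ) {t : ℝ} (ht : 0 < t) :
    phiConvolution m n t ≤ t ^ (m + n + 1) * phiKernel t *
      (m.factorial * n.factorial / (m + n + 1).factorial) := by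
  have h : ∫ s in 0..t, phiKernel t * (s ^ m * (t - s) ^ n) = t ^ (m + n + 1) * phiKernel t *
      (m.factorial * n.factorial / (m + n + 1).factorial) := by
    rw [intervalIntegral.integral_const_mul, integral_pow_mul_sub_pow m n ht]
    ring
  rw [← h, phiConvolution, intervalIntegral.integral_of_le ht.le,
    intervalIntegral.integral_of_le ht.le, integral_Ioc_eq_integral_Ioo,
    integral_Ioc_eq_integral_Ioo]
  refine integral_mono_of_nonneg ?_ ?_ ?_
  · refine (ae_restrict_iff' measurableSet_Ioo).2 (ae_of_all _ fun s hs ↦ ?_)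
    have h1 := phiKernel_nonneg s
    have h2 := phiKernel_nonneg (t - s)
    have h3 := sub_nonneg.2 hs.2.le
    have h4 := hs.1.le
    simp only [Pi.zero_apply]
    positivity
  · refine IntegrableOn.mono_set (t := Icc 0 t) ?_ Ioo_subset_Icc_self
    exact Continuous.integrableOn_Icc (by fun_prop)
  · refine (ae_restrict_iff' measurableSet_Ioo).2 (ae_of_all _ fun s hs ↦ ?_)
    have h1 := phiKernel_mul_le hs.1 hs.2
    have h3 := sub_nonneg.2 hs.2.le
    have h4 := hs.1.le
    calc s ^ m * phiKernel s * ((t - s) ^ n * phiKernel (t - s))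
        = phiKernel s * phiKernel (t - s) * (s ^ m * (t - s) ^ n) := by ring
      _ ≤ phiKernel t * (s ^ m * (t - s) ^ n) := by gcongr

theorem phiConvolution_mul_exp (m n : ℕ) (x t : ℝ) :
    phiConvolution m n t * exp (-(x * t)) = ∫ s in 0..t,
      s ^ m * phiKernel s * exp (-(x * s)) *
        ((t - s) ^ n * phiKernel (t - s) * exp (-(x * (t - s)))) := by
  rw [phiConvolution, ← intervalIntegral.integral_mul_const]
  congr with s
  rw [show -(x * t) = -(x * s) + -(x * (t - s)) by ring, exp_add]
  ring

theorem integrableOn_phiConvolution (m n : ℕ) {x : ℝ} (hx : 0 < x) :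
    IntegrableOn (fun t ↦ phiConvolution m n t * exp (-(x * t))) (Ioi 0) := by
  have h := (integrable_posConvolution (integrableOn_pow_mul_phiKernel m hx)
    (integrableOn_pow_mul_phiKernel n hx) (ContinuousLinearMap.mul ℝ ℝ)).integrableOn (s := Ioi 0)
  refine h.congr_fun (fun t ht ↦ ?_) measurableSet_Ioi
  rw [posConvolution, indicator_of_mem ht]
  exact (phiConvolution_mul_exp m n x t).symm

theorem laplaceTransform_phiConvolution (m n : ℕ) {x : ℝ} (hx : 0 < x) :
    laplaceTransform (phiConvolution m n) x =
      laplaceTransform (fun t ↦ t ^ m * phiKernel t) x *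
        laplaceTransform (fun t ↦ t ^ n * phiKernel t) x := by
  have h := integral_posConvolution (integrableOn_pow_mul_phiKernel m hx)
    (integrableOn_pow_mul_phiKernel n hx) (ContinuousLinearMap.mul ℝ ℝ)
  simp_rw [ContinuousLinearMap.mul_apply', ← phiConvolution_mul_exp] at h
  exact h

theorem iteratedDeriv_Phi_add_mul (m n : ℕ) (ω : ℝ) {x : ℝ} (hx : 0 < x) :
    (-1 : ℝ) ^ (m + n + 1) *
        (iteratedDeriv (m + n + 1) Phi x + ω * iteratedDeriv m Phi x * iteratedDeriv n Phi x) =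
      laplaceTransform (fun t ↦ t ^ (m + n + 1) * phiKernel t) x -
        ω * (laplaceTransform (fun t ↦ t ^ m * phiKernel t) x *
          laplaceTransform (fun t ↦ t ^ n * phiKernel t) x) := by
  rw [iteratedDeriv_Phi _ hx, iteratedDeriv_Phi _ hx, iteratedDeriv_Phi _ hx]
  have hm : ((-1 : ℝ) ^ m) ^ 2 = 1 := by rw [← pow_mul, mul_comm, pow_mul]; simp
  have hn : ((-1 : ℝ) ^ n) ^ 2 = 1 := by rw [← pow_mul, mul_comm, pow_mul]; simp
  rw [pow_succ, pow_add]
  linear_combination (laplaceTransform (fun t ↦ t ^ (m + n + 1) * phiKernel t) x -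
    ω * (laplaceTransform (fun t ↦ t ^ m * phiKernel t) x *
      laplaceTransform (fun t ↦ t ^ n * phiKernel t) x)) *
    (((-1 : ℝ) ^ n) ^ 2 * hm + hn)

end convolution

theorem calY_neg_completelyMonotonic_iff (m n : ℕ) (ω : ℝ) :
    CompletelyMonotonicOn
      (fun x => (-1:ℝ) ^ (m + n + 1) *
        (iteratedDeriv (m + n + 1) Phi x + ω * iteratedDeriv m Phi x * iteratedDeriv n Phi x))
      (Set.Ioi 0) ↔
    ω ≤ (Nat.factorial (m + n + 1) : ℝ) / (Nat.factorial m * Nat.factorial n) := by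
  constructor
  · rintro ⟨-, h⟩
    have hlim (k : ℕ) := tendsto_pow_mul_laplaceTransform k continuousOn_phiKernel
      (fun _ ht ↦ abs_phiKernel_le_one ht) tendsto_phiKernel_atTop
    have hω := (hlim (m + n + 1)).sub (((hlim m).mul (hlim n)).const_mul ω)
    have h0 := ge_of_tendsto (b := 0) hω <| by
      filter_upwards [self_mem_nhdsWithin] with x (hx : 0 < x)
      have hf := h 0 x hx
      rw [iteratedDeriv_zero, iteratedDeriv_Phi_add_mul m n ω hx, pow_zero, one_mul] at hf
      refine (mul_nonneg (pow_nonneg hx.le (m + n + 2)) hf).trans_eq ?_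
      ring
    rw [le_div_iff₀ (by positivity)]
    linarith
  · intro hω
    refine completelyMonotonicOn_of_eqOn_laplaceTransform
      (K := fun t ↦ t ^ (m + n + 1) * phiKernel t - ω * phiConvolution m n t)
      (fun t ht ↦ ?_) (fun x hx ↦ ?_) fun x hx ↦ ?_
    · have h0 := phiConvolution_nonneg m n ht
      have h1 := phiConvolution_le m n ht
      have hcancel : ((m + n + 1).factorial : ℝ) / (m.factorial * n.factorial) *
          (t ^ (m + n + 1) * phiKernel t * (m.factorial * n.factorial / (m + n + 1).factorial)) =
            t ^ (m + n + 1) * phiKernel t := by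
        have hm : (m.factorial : ℝ) ≠ 0 := Nat.cast_ne_zero.2 m.factorial_ne_zero
        have hn : (n.factorial : ℝ) ≠ 0 := Nat.cast_ne_zero.2 n.factorial_ne_zero
        have hmn : ((m + n + 1).factorial : ℝ) ≠ 0 := Nat.cast_ne_zero.2 (Nat.factorial_ne_zero _)
        field_simp
      rw [sub_nonneg, ← hcancel]
      exact mul_le_mul hω h1 h0 (by positivity)
    · refine ((integrableOn_pow_mul_phiKernel (m + n + 1) hx).sub
        ((integrableOn_phiConvolution m n hx).const_mul ω)).congr (ae_of_all _ fun t ↦ ?_)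
      simp only [Pi.sub_apply]
      ring
    · refine (iteratedDeriv_Phi_add_mul m n ω hx).trans ?_
      rw [← laplaceTransform_phiConvolution m n hx, laplaceTransform, laplaceTransform,
        laplaceTransform, ← integral_const_mul, ← integral_sub
          (integrableOn_pow_mul_phiKernel (m + n + 1) hx)
          ((integrableOn_phiConvolution m n hx).const_mul ω)]
      congr with t
      ring
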